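/- arXiv:1309.4046 — 2 statements merged into one kernel-verified Lean document; each statement's English description precedes it below -/
import Mathlib

section
/- Let φ be convex and C¹ on (0,1) and assume the relative entropy H defined by H(A,B) = tr(φ(A) − φ(B) − φ'(B)(A−B)) satisfies the monotonicity H(XAX*, XBX*) ≤ H(A,B) for all contractions X and all Hermitian 0 ≤ A,B ≤ 1 on finite-dimensional spaces. Then for every Hermitian matrix A with 0 < A < 1 and every orthogonal projection P (with block notation A₁₁ = PAP restricted to the range of P), one has (A·φ'(A))₁₁ ≥ A₁₁·φ'(A₁₁) in the sense of Hermitian matrices. -/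
open Set ComplexOrder Matrix

lemma aux_tangent (φ : ℝ → ℝ) (hconv : ConvexOn ℝ (Ioo 0 1) φ)
    (hdiff : DifferentiableOn ℝ φ (Ioo 0 1)) {a b : ℝ} (ha : a ∈ Ioo (0:ℝ) 1)
    (hb : b ∈ Ioo (0:ℝ) 1) : 0 ≤ φ a - φ b - deriv φ b * (a - b) := by
  have hd : DifferentiableAt ℝ φ b := (hdiff b hb).differentiableAt (isOpen_Ioo.mem_nhds hb)
  rcases lt_trichotomy a b with h | h | h
  · have := hconv.slope_le_deriv ha hb h hd
    rw [slope_def_field, div_le_iff₀ (by linarith)] at this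
    linarith
  · subst h; simp
  · have := hconv.deriv_le_slope hb ha h hd
    rw [slope_def_field, le_div_iff₀ (by linarith)] at this
    linarith

lemma aux_trace_mul {n : ℕ} {A B : Matrix (Fin n) (Fin n) ℂ} (hA : A.IsHermitian)
    (hB : B.IsHermitian) : ∃ w : Fin n → Fin n → ℝ, (∀ i j, 0 ≤ w i j) ∧ ∀ f g : ℝ → ℝ,
    (cfc f A * cfc g B).trace =
      ((∑ i, ∑ j, w i j * (f (hA.eigenvalues i) * g (hB.eigenvalues j)) : ℝ) : ℂ) := by
  set U : Matrix (Fin n) (Fin n) ℂ := (hA.eigenvectorUnitary : Matrix (Fin n) (Fin n) ℂ) with hU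
  set W : Matrix (Fin n) (Fin n) ℂ := (hB.eigenvectorUnitary : Matrix (Fin n) (Fin n) ℂ) with hW
  refine ⟨fun i j => Complex.normSq ((star U * W) i j), fun i j => Complex.normSq_nonneg _, ?_⟩
  intro f g
  rw [hA.cfc_eq, hB.cfc_eq, IsHermitian.cfc, IsHermitian.cfc, Unitary.conjStarAlgAut_apply,
    Unitary.conjStarAlgAut_apply]
  simp only [← hU, ← hW]
  set D := diagonal ((RCLike.ofReal : ℝ → ℂ) ∘ f ∘ hA.eigenvalues)
  set E := diagonal ((RCLike.ofReal : ℝ → ℂ) ∘ g ∘ hB.eigenvalues)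
  have h1 : (U * D * star U * (W * E * star W)).trace
      = (D * (star U * W) * (E * star (star U * W))).trace := by
    rw [star_mul, star_star, mul_assoc U D, mul_assoc U, trace_mul_comm]
    simp only [mul_assoc]
  rw [h1]
  simp only [trace, diag, mul_apply (M := D * (star U * W)), D, E, diagonal_mul, Function.comp]
  push_cast
  refine Finset.sum_congr rfl fun i _ => Finset.sum_congr rfl fun j _ => ?_
  rw [star_apply, Complex.normSq_eq_conj_mul_self]
  simp only [RCLike.star_def, Complex.coe_algebraMap]
  ring

lemma aux_klein (φ : ℝ → ℝ) (hconv : ConvexOn ℝ (Ioo 0 1) φ)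
    (hdiff : DifferentiableOn ℝ φ (Ioo 0 1)) {n : ℕ} {A B : Matrix (Fin n) (Fin n) ℂ}
    (hA : A.IsHermitian) (hB : B.IsHermitian) (sA : spectrum ℝ A ⊆ Ioo 0 1)
    (sB : spectrum ℝ B ⊆ Ioo 0 1) :
    (cfc (deriv φ) B * (A - B)).trace.re ≤ (cfc φ A).trace.re - (cfc φ B).trace.re := by
  obtain ⟨w, hw, h⟩ := aux_trace_mul hA hB
  have hA' : IsSelfAdjoint A := hA
  have hB' : IsSelfAdjoint B := hB
  have e1 := h φ (fun _ => 1)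
  rw [cfc_const_one ℝ B, mul_one] at e1
  have e2 := h (fun _ => 1) φ
  rw [cfc_const_one ℝ A, one_mul] at e2
  have e3 := h (fun x => x) (deriv φ)
  rw [cfc_id' ℝ A, trace_mul_comm] at e3
  have e4 := h (fun _ => 1) (fun x => deriv φ x * x)
  rw [cfc_const_one ℝ A, one_mul, cfc_mul (deriv φ) (fun x => x) B
    (B.finite_real_spectrum.continuousOn _), cfc_id' ℝ B] at e4
  rw [mul_sub, trace_sub, Complex.sub_re, e1, e2, e3, e4, Complex.ofReal_re, Complex.ofReal_re, Complex.ofReal_re,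
    Complex.ofReal_re, ← sub_nonneg]
  simp only [← Finset.sum_sub_distrib]
  refine Finset.sum_nonneg fun i _ => Finset.sum_nonneg fun j _ => ?_
  have := mul_nonneg (hw i j) (aux_tangent φ hconv hdiff (sA (hA.eigenvalues_mem_spectrum_real i))
    (sB (hB.eigenvalues_mem_spectrum_real j)))
  linarith

lemma aux_spec {n : ℕ} {A : Matrix (Fin n) (Fin n) ℂ} (hA : A.PosDef) (hA1 : (1 - A).PosDef) :
    spectrum ℝ A ⊆ Ioo 0 1 := by
  have key : ∀ {B : Matrix (Fin n) (Fin n) ℂ}, B.PosDef → ∀ x ∈ spectrum ℝ B, 0 < x := by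
    intro B hB x hx
    rw [hB.1.spectrum_real_eq_range_eigenvalues] at hx
    obtain ⟨i, rfl⟩ := hx
    exact hB.eigenvalues_pos i
  intro x hx
  refine ⟨key hA x hx, ?_⟩
  have : 1 - x ∈ spectrum ℝ (1 - A) := by
    have := (spectrum.sub_singleton_eq (R := ℝ) A 1)
    have h2 := spectrum.singleton_sub_eq (R := ℝ) A 1
    rw [map_one] at h2
    rw [← h2]
    exact Set.sub_mem_sub rfl hx
  linarith [key hA1 _ this]

lemma aux_intertwine {n k : ℕ} (f : ℝ → ℝ) {B : Matrix (Fin n) (Fin n) ℂ}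
    {C : Matrix (Fin k) (Fin k) ℂ} (hB : B.IsHermitian) (hC : C.IsHermitian)
    {V : Matrix (Fin k) (Fin n) ℂ} (h : V * B = C * V) : V * cfc f B = cfc f C * V := by
  have fB := B.finite_real_spectrum
  have fC := C.finite_real_spectrum
  set s : Finset ℝ := (fB.union fC).toFinset
  set p : Polynomial ℝ := Lagrange.interpolate s id f
  have hp : ∀ x ∈ spectrum ℝ B ∪ spectrum ℝ C, f x = p.eval x := by
    intro x hx
    exact (Lagrange.eval_interpolate_at_node f (Function.injective_id.injOn) (by simpa [s] using hx)).symm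
  have hB' : IsSelfAdjoint B := hB
  have hC' : IsSelfAdjoint C := hC
  rw [cfc_congr (g := p.eval) fun x hx => hp x (Or.inl hx), cfc_congr (a := C) (g := p.eval) fun x hx => hp x (Or.inr hx),
    cfc_polynomial p B, cfc_polynomial p C]
  induction p using Polynomial.induction_on' with
  | add p q hp hq => simp only [map_add, Matrix.mul_add, Matrix.add_mul, hp, hq]
  | monomial m a =>
    have : V * B ^ m = C ^ m * V := by
      induction m with
      | zero => simp
      | succ m ih => rw [pow_succ, ← Matrix.mul_assoc, ih, Matrix.mul_assoc, h, pow_succ, Matrix.mul_assoc]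
    simp [Polynomial.aeval_monomial, Algebra.algebraMap_eq_smul_one, this]

open scoped Matrix.Norms.L2Operator in
lemma aux_cont {n : ℕ} (f : ℝ → ℝ) (hf : ContinuousOn f (Ioo 0 1))
    {M : ℝ → Matrix (Fin n) (Fin n) ℂ} (hM : Continuous M) (hh : ∀ t, (M t).IsHermitian)
    (h0 : spectrum ℝ (M 0) ⊆ Ioo 0 1) :
    (∀ᶠ t in nhds 0, spectrum ℝ (M t) ⊆ Ioo 0 1) ∧
    Filter.Tendsto (fun t => cfc f (M t)) (nhds 0) (nhds (cfc f (M 0))) := by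
  obtain ⟨S, ⟨hS₁, hS₂⟩, hS₃⟩ :=
    (spectrum.isCompact (𝕜 := ℝ) (M 0)).nhdsSet_basis_isCompact.mem_iff.mp
      (isOpen_Ioo.mem_nhdsSet.2 h0)
  have key : ∀ᶠ t in nhds 0, spectrum ℝ (M t) ⊆ S := by
    have := (upperHemicontinuous_spectrum ℝ (Matrix (Fin n) (Fin n) ℂ)).upperHemicontinuousAt
      (M 0) _ hS₁ |>.mono fun _ ↦ subset_of_mem_nhdsSet
    exact hM.continuousAt.eventually this
  refine ⟨key.mono fun t ht => ht.trans hS₃, ?_⟩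
  exact Filter.Tendsto.cfc hS₂ f hM.continuousAt key (Filter.Eventually.of_forall hh)
    (key.self_of_nhds) (hh 0) (hf.mono hS₃)

lemma aux_pinch_trace {n : ℕ} {S C A B : Matrix (Fin n) (Fin n) ℂ} (hS : S * S = 1)
    (hC : S * C = C * S) (hB : B = (2⁻¹ : ℝ) • (A + S * A * S)) :
    (C * (A - B)).trace = 0 := by
  have h : (C * (S * A * S)).trace = (C * A).trace := by
    rw [← Matrix.mul_assoc, trace_mul_comm, ← Matrix.mul_assoc, ← Matrix.mul_assoc, hC,
      Matrix.mul_assoc C S S, hS, Matrix.mul_one]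
  rw [hB, Matrix.mul_sub, Matrix.mul_smul, Matrix.mul_add, trace_sub, trace_smul, trace_add, h,
    ← two_smul ℝ, smul_smul]
  norm_num

lemma aux_pinch_pos {n : ℕ} {S A : Matrix (Fin n) (Fin n) ℂ} (hS : S.IsHermitian)
    (hA : A.PosDef) : ((2⁻¹ : ℝ) • (A + S * A * S)).PosDef := by
  have h : (S * A * S).PosSemidef := by
    have := hA.posSemidef.mul_mul_conjTranspose_same S
    rwa [hS.eq] at this
  exact (hA.add_posSemidef h).smul (by norm_num)

theorem aux_main (φ : ℝ → ℝ)
    (hconv : ConvexOn ℝ (Ioo 0 1) φ)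
    (hdiff : DifferentiableOn ℝ φ (Ioo 0 1))
    (hderiv_cont : ContinuousOn (deriv φ) (Ioo 0 1))
    (hmono : ∀ (n m : ℕ) (X : Matrix (Fin m) (Fin n) ℂ), (1 - Xᴴ * X).PosSemidef →
      ∀ A B : Matrix (Fin n) (Fin n) ℂ,
        A.PosSemidef → (1 - A).PosSemidef → B.PosSemidef → (1 - B).PosSemidef →
        (cfc φ (X * A * Xᴴ) - cfc φ (X * B * Xᴴ) -
            cfc (deriv φ) (X * B * Xᴴ) * (X * A * Xᴴ - X * B * Xᴴ)).trace ≤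
          (cfc φ A - cfc φ B - cfc (deriv φ) B * (A - B)).trace)
    (n : ℕ) (A B S : Matrix (Fin n) (Fin n) ℂ)
    (hApos : A.PosDef) (hAlt : (1 - A).PosDef) (hS : S * S = 1) (hSh : S.IsHermitian)
    (hB : B = (2⁻¹ : ℝ) • (A + S * A * S)) (w : Fin n → ℂ) (hw : S *ᵥ w = w) :
    (star w ⬝ᵥ (B * cfc (deriv φ) B) *ᵥ w).re ≤ (star w ⬝ᵥ (A * cfc (deriv φ) A) *ᵥ w).re := by
  have hBpos : B.PosDef := hB ▸ aux_pinch_pos hSh hApos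
  have hBlt : (1 - B).PosDef := by
    have := aux_pinch_pos hSh hAlt
    convert this using 1
    rw [hB, Matrix.mul_sub, Matrix.mul_one, Matrix.sub_mul, hS]
    module
  have hSB : S * B = B * S := by
    rw [hB, Matrix.mul_smul, Matrix.smul_mul, Matrix.mul_add, Matrix.add_mul, Matrix.mul_assoc _ S S,
      hS, Matrix.mul_assoc S A S, ← Matrix.mul_assoc S S, hS, Matrix.mul_one, Matrix.one_mul,
      add_comm]
  set K : Matrix (Fin n) (Fin n) ℂ := vecMulVec w (star w) with hK
  have hKh : K.IsHermitian := by
    ext i j; simp [hK, vecMulVec_apply, mul_comm]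
  have hKpos : K.PosSemidef := posSemidef_vecMulVec_self_star w
  obtain ⟨c, hc0, hc⟩ : ∃ c : ℝ, 0 ≤ c ∧ K * K = c • K := by
    refine ⟨(star w ⬝ᵥ w).re, ?_, ?_⟩
    · exact (Complex.le_def.1 (dotProduct_star_self_nonneg w)).1
    · have h0 : star w ⬝ᵥ w = ((star w ⬝ᵥ w).re : ℂ) := by
        apply Complex.ext
        · simp
        · simpa using (Complex.le_def.1 (dotProduct_star_self_nonneg w)).2.symm
      rw [hK, vecMulVec_mul_vecMulVec, h0]
      ext i j
      simp [vecMulVec_apply, mul_left_comm]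
  have hSK : S * K = K * S := by
    have h1 : S * K = K := by rw [hK, mul_vecMulVec, hw]
    have h2 : K * S = K := by
      have := congrArg conjTranspose h1
      rwa [conjTranspose_mul, hKh.eq, hSh.eq] at this
    rw [h1, h2]
  set X : ℝ → Matrix (Fin n) (Fin n) ℂ := fun t => 1 - t • K with hX
  have hXh : ∀ t, (X t)ᴴ = X t := by
    intro t; simp [hX, conjTranspose_sub, conjTranspose_smul, hKh.eq]
  have hXc : Continuous X := by fun_prop
  have hXS : ∀ t, S * X t = X t * S := by
    intro t; simp [hX, Matrix.mul_sub, Matrix.sub_mul, hSK]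
  have hX0 : X 0 = 1 := by simp [hX]
  have hherm : ∀ {M : Matrix (Fin n) (Fin n) ℂ}, M.IsHermitian → ∀ t, (X t * M * X t).IsHermitian := by
    intro M hM t
    have := isHermitian_mul_mul_conjTranspose (X t) hM
    rwa [hXh] at this
  have cA := aux_cont (deriv φ) hderiv_cont (M := fun t => X t * A * X t) (by fun_prop)
    (hherm hApos.1) (by simpa [hX0] using aux_spec hApos hAlt)
  have cB := aux_cont (deriv φ) hderiv_cont (M := fun t => X t * B * X t) (by fun_prop)
    (hherm hBpos.1) (by simpa [hX0] using aux_spec hBpos hBlt)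
  have hD : ∀ (M : Matrix (Fin n) (Fin n) ℂ) (t : ℝ),
      X t * M * X t - M = t • (t • (K * M * K) - (K * M + M * K)) := by
    intro M t
    simp only [hX, Matrix.sub_mul, Matrix.mul_sub, Matrix.smul_mul, Matrix.mul_smul,
      Matrix.one_mul, Matrix.mul_one]
    module
  have hcontr : ∀ᶠ t : ℝ in nhdsWithin 0 (Ioi 0), (1 - (X t)ᴴ * X t).PosSemidef := by
    have h1 : ∀ᶠ t : ℝ in nhds 0, t * c < 2 := by
      have : Continuous fun t : ℝ => t * c := by fun_prop
      exact this.continuousAt.eventually (gt_mem_nhds (by simp))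
    filter_upwards [nhdsWithin_le_nhds h1, self_mem_nhdsWithin] with t ht ht0
    have e : 1 - (X t)ᴴ * X t = (t * (2 - t * c)) • K := by
      rw [hXh]
      simp only [hX, Matrix.sub_mul, Matrix.mul_sub, Matrix.smul_mul, Matrix.mul_smul,
        Matrix.one_mul, Matrix.mul_one, hc]
      module
    rw [e]
    exact hKpos.smul (mul_nonneg (le_of_lt ht0) (by linarith))
  have hcfcB : ∀ {M : Matrix (Fin n) (Fin n) ℂ}, M.IsHermitian → S * M = M * S →
      S * cfc (deriv φ) M = cfc (deriv φ) M * S := fun hM h => aux_intertwine _ hM hM h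
  have hev : ∀ᶠ t : ℝ in nhdsWithin 0 (Ioi 0),
      (cfc (deriv φ) A * (t • (K * A * K) - (K * A + A * K))).trace.re ≤
      (cfc (deriv φ) (X t * B * X t) * (t • (K * B * K) - (K * B + B * K))).trace.re := by
    filter_upwards [nhdsWithin_le_nhds cA.1, nhdsWithin_le_nhds cB.1, hcontr,
      self_mem_nhdsWithin] with t hAt hBt hXt ht0
    have hSBt : S * (X t * B * X t) = X t * B * X t * S := by
      rw [← Matrix.mul_assoc, ← Matrix.mul_assoc, hXS, Matrix.mul_assoc (X t) S B, hSB,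
        ← Matrix.mul_assoc, Matrix.mul_assoc _ S, hXS, ← Matrix.mul_assoc]
    have m := hmono n n (X t) hXt A B hApos.posSemidef hAlt.posSemidef hBpos.posSemidef
      hBlt.posSemidef
    rw [hXh] at m
    have hBt' : X t * B * X t = (2⁻¹ : ℝ) • (X t * A * X t + S * (X t * A * X t) * S) := by
      have : S * (X t * A * X t) * S = X t * (S * A * S) * X t := by
        simp only [Matrix.mul_assoc]
        rw [← Matrix.mul_assoc S (X t), hXS, Matrix.mul_assoc]
      rw [this, hB, Matrix.mul_smul, Matrix.smul_mul, Matrix.mul_add, Matrix.add_mul]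
    rw [trace_sub _ (_ * _), trace_sub _ (cfc (deriv φ) B * _),
      aux_pinch_trace hS (hcfcB hBpos.1 hSB) hB,
      aux_pinch_trace hS (hcfcB (hherm hBpos.1 t) hSBt) hBt', trace_sub, trace_sub, sub_zero,
      sub_zero] at m
    have m' := (Complex.le_def.1 m).1
    simp only [Complex.sub_re] at m'
    have k1 := aux_klein φ hconv hdiff (hherm hApos.1 t) hApos.1 hAt (aux_spec hApos hAlt)
    have k2 := aux_klein φ hconv hdiff hBpos.1 (hherm hBpos.1 t) (aux_spec hBpos hBlt) hBt
    rw [← neg_sub (X t * B * X t), Matrix.mul_neg, trace_neg, Complex.neg_re] at k2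
    rw [hD, Matrix.mul_smul, trace_smul, Complex.smul_re, smul_eq_mul] at k1 k2
    have : t * (cfc (deriv φ) A * (t • (K * A * K) - (K * A + A * K))).trace.re ≤
      t * (cfc (deriv φ) (X t * B * X t) * (t • (K * B * K) - (K * B + B * K))).trace.re := by
      linarith
    exact le_of_mul_le_mul_left this ht0
  have hlim := by
    refine le_of_tendsto_of_tendsto (b := nhdsWithin (0:ℝ) (Ioi 0))
      (a₁ := (cfc (deriv φ) A * ((0:ℝ) • (K * A * K) - (K * A + A * K))).trace.re)
      (a₂ := (cfc (deriv φ) (X 0 * B * X 0) *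
        ((0:ℝ) • (K * B * K) - (K * B + B * K))).trace.re) ?_ ?_ hev
    · have : Continuous fun t : ℝ =>
        (cfc (deriv φ) A * (t • (K * A * K) - (K * A + A * K))).trace.re := by fun_prop
      exact this.continuousAt.tendsto.mono_left nhdsWithin_le_nhds
    · have h1 : Continuous fun M : Matrix (Fin n) (Fin n) ℂ × ℝ =>
          (M.1 * (M.2 • (K * B * K) - (K * B + B * K))).trace.re := by fun_prop
      have h2 := cB.2.prodMk_nhds (Filter.tendsto_id (x := nhds (0:ℝ)))
      exact ((h1.continuousAt.tendsto.comp h2)).mono_left nhdsWithin_le_nhds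
  have hfin : ∀ {M : Matrix (Fin n) (Fin n) ℂ}, M.IsHermitian →
      (cfc (deriv φ) M * ((0:ℝ) • (K * M * K) - (K * M + M * K))).trace.re =
        - 2 * (star w ⬝ᵥ (M * cfc (deriv φ) M) *ᵥ w).re := by
    intro M hM
    have hcomm : M * cfc (deriv φ) M = cfc (deriv φ) M * M := aux_intertwine _ hM hM rfl
    have h1 : (cfc (deriv φ) M * (K * M)).trace = star w ⬝ᵥ (M * cfc (deriv φ) M) *ᵥ w := by
      rw [← Matrix.mul_assoc, trace_mul_comm, ← Matrix.mul_assoc, hK, mul_vecMulVec,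
        trace_vecMulVec, dotProduct_comm]
    have h2 : (cfc (deriv φ) M * (M * K)).trace = star w ⬝ᵥ (M * cfc (deriv φ) M) *ᵥ w := by
      rw [← Matrix.mul_assoc, ← hcomm, hK, mul_vecMulVec,
        trace_vecMulVec, dotProduct_comm]
    rw [zero_smul, zero_sub, Matrix.mul_neg, Matrix.mul_add, trace_neg, trace_add, h1, h2]
    simp only [Complex.neg_re, Complex.add_re]
    ring
  rw [hX0, Matrix.one_mul, Matrix.mul_one, hfin hApos.1, hfin hBpos.1] at hlim
  linarith


open Set ComplexOrder Matrix

/-- If the relative entropy `H(A,B) = tr (φ(A) - φ(B) - φ'(B)(A-B))` associated with a convex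
`C¹` function `φ` on `(0,1)` is monotone under all contractions `X` (i.e.
`H(XAX*, XBX*) ≤ H(A,B)` for `X*X ≤ 1` and `0 ≤ A, B ≤ 1`), then for every Hermitian `A` with
`0 < A < 1` and every orthogonal projection (realized via a coisometry `V` with `V Vᴴ = 1`
onto its range, so that `A₁₁ = V A Vᴴ`), one has `(A φ'(A))₁₁ ≥ A₁₁ φ'(A₁₁)` in the Loewner
order. -/
theorem monotonicity_implies_operator_monotonicity_key_step (φ : ℝ → ℝ)
    (hconv : ConvexOn ℝ (Ioo 0 1) φ)
    (hdiff : DifferentiableOn ℝ φ (Ioo 0 1))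
    (hderiv_cont : ContinuousOn (deriv φ) (Ioo 0 1))
    (hmono : ∀ (n m : ℕ) (X : Matrix (Fin m) (Fin n) ℂ), (1 - Xᴴ * X).PosSemidef →
      ∀ A B : Matrix (Fin n) (Fin n) ℂ,
        A.PosSemidef → (1 - A).PosSemidef → B.PosSemidef → (1 - B).PosSemidef →
        (cfc φ (X * A * Xᴴ) - cfc φ (X * B * Xᴴ) -
            cfc (deriv φ) (X * B * Xᴴ) * (X * A * Xᴴ - X * B * Xᴴ)).trace ≤
          (cfc φ A - cfc φ B - cfc (deriv φ) B * (A - B)).trace)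
    (n k : ℕ) (A : Matrix (Fin n) (Fin n) ℂ) (hA : IsSelfAdjoint A)
    (hApos : A.PosDef) (hAlt : (1 - A).PosDef)
    (V : Matrix (Fin k) (Fin n) ℂ) (hV : V * Vᴴ = 1) :
    (V * (A * cfc (deriv φ) A) * Vᴴ -
      (V * A * Vᴴ) * cfc (deriv φ) (V * A * Vᴴ)).PosSemidef := by
  set P : Matrix (Fin n) (Fin n) ℂ := Vᴴ * V with hP
  have hPP : P * P = P := by
    rw [hP, Matrix.mul_assoc, ← Matrix.mul_assoc V, hV, Matrix.one_mul]
  have hPh : P.IsHermitian := isHermitian_conjTranspose_mul_self V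
  set S : Matrix (Fin n) (Fin n) ℂ := (2:ℝ) • P - 1 with hSdef
  have hSS : S * S = 1 := by
    simp only [hSdef, Matrix.sub_mul, Matrix.mul_sub, Matrix.smul_mul, Matrix.mul_smul,
        Matrix.one_mul, Matrix.mul_one, hPP]
    module
  have hSh : S.IsHermitian := by
    rw [IsHermitian, hSdef, conjTranspose_sub, conjTranspose_smul, hPh.eq]
    simp
  have hVS : V * S = V := by
    rw [hSdef, hP, Matrix.mul_sub, Matrix.mul_smul, ← Matrix.mul_assoc, hV, Matrix.one_mul,
      Matrix.mul_one]
    module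
  have hSV : S * Vᴴ = Vᴴ := by
    have := congrArg conjTranspose hVS
    rwa [conjTranspose_mul, hSh.eq] at this
  set B : Matrix (Fin n) (Fin n) ℂ := (2⁻¹ : ℝ) • (A + S * A * S) with hB
  have hBh : B.IsHermitian := (aux_pinch_pos hSh hApos).1
  have hCh : (V * A * Vᴴ).IsHermitian := isHermitian_mul_mul_conjTranspose V hApos.1
  have hVB : V * B = (V * A * Vᴴ) * V := by
    rw [hB, Matrix.mul_smul, Matrix.mul_add, ← Matrix.mul_assoc, ← Matrix.mul_assoc, hVS,
      Matrix.mul_assoc _ Vᴴ V, ← hP]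
    rw [hSdef, Matrix.mul_sub, Matrix.mul_smul, Matrix.mul_one]
    module
  have hVf := aux_intertwine (deriv φ) hBh hCh hVB
  have hVBf : V * (B * cfc (deriv φ) B) * Vᴴ =
      (V * A * Vᴴ) * cfc (deriv φ) (V * A * Vᴴ) := by
    rw [← Matrix.mul_assoc V, hVB, Matrix.mul_assoc _ V, hVf, Matrix.mul_assoc,
      Matrix.mul_assoc _ V, hV, Matrix.mul_one]
  have hher : ∀ {m : ℕ} {M : Matrix (Fin m) (Fin m) ℂ}, M.IsHermitian →
      (M * cfc (deriv φ) M).IsHermitian := by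
    intro m M hM
    have hcomm : M * cfc (deriv φ) M = cfc (deriv φ) M * M := aux_intertwine _ hM hM rfl
    have hf : (cfc (deriv φ) M).IsHermitian := cfc_predicate (deriv φ) M
    rw [IsHermitian, conjTranspose_mul, hM.eq, hf.eq, hcomm]
  have hH : (V * (A * cfc (deriv φ) A) * Vᴴ -
      (V * A * Vᴴ) * cfc (deriv φ) (V * A * Vᴴ)).IsHermitian :=
    (isHermitian_mul_mul_conjTranspose V (hher hApos.1)).sub (hher hCh)
  refine PosSemidef.of_dotProduct_mulVec_nonneg hH fun v => ?_
  have hw : S *ᵥ (Vᴴ *ᵥ v) = Vᴴ *ᵥ v := by rw [mulVec_mulVec, hSV]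
  have key := aux_main φ hconv hdiff hderiv_cont hmono n A B S hApos hAlt hSS hSh hB _ hw
  have conv : ∀ M : Matrix (Fin n) (Fin n) ℂ,
      star (Vᴴ *ᵥ v) ⬝ᵥ M *ᵥ (Vᴴ *ᵥ v) = star v ⬝ᵥ (V * M * Vᴴ) *ᵥ v := by
    intro M
    rw [star_mulVec, conjTranspose_conjTranspose, ← dotProduct_mulVec, mulVec_mulVec,
      mulVec_mulVec, Matrix.mul_assoc]
  rw [conv, conv, hVBf] at key
  refine Complex.le_def.2 ⟨?_, ?_⟩
  · rw [sub_mulVec, dotProduct_sub, Complex.sub_re, Complex.zero_re]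
    linarith
  · exact (hH.im_star_dotProduct_mulVec_self v).symm
end

section
/- Let 0 ≤ A, B ≤ 1 be Hermitian N×N matrices and suppose φ is continuous on [0,1] with φ' operator monotone and nonconstant on (0,1). Then there is a constant C > 0 depending only on φ such that tr(φ(A) − φ(B) − φ'(B)(A−B)) ≥ C · tr((A−B)²); in particular H(A,B) ≥ C·‖A−B‖²_HS. -/
open Set ComplexOrder Matrix

lemma k_spec2 (a b d μ₁ μ₂ : ℝ) (h1 : a + d = μ₁ + μ₂) (h2 : a * d - b * b = μ₁ * μ₂) :
    spectrum ℝ (!![(a:ℂ), b; b, d]) ⊆ {μ₁, μ₂} := by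
  intro x hx
  rw [spectrum.mem_iff, Matrix.isUnit_iff_isUnit_det, Matrix.det_fin_two] at hx
  simp [Matrix.algebraMap_matrix_apply] at hx
  have : (x - a) * (x - d) - b * b = 0 := by exact_mod_cast hx
  have h3 : (x - μ₁) * (x - μ₂) = 0 := by linear_combination this + x * h1 - h2
  rcases mul_eq_zero.1 h3 with h | h
  · left; linarith
  · right; simp; linarith

lemma k_sa2 (a b d : ℝ) : IsSelfAdjoint (!![(a:ℂ), b; b, d]) := by
  ext i j; fin_cases i <;> fin_cases j <;> simp [Matrix.star_apply]

lemma k_cfc2 (f : ℝ → ℝ) (a b d μ₁ μ₂ α β : ℝ) (h1 : a + d = μ₁ + μ₂)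
    (h2 : a * d - b * b = μ₁ * μ₂) (e1 : f μ₁ = α + β * μ₁) (e2 : f μ₂ = α + β * μ₂) :
    cfc f (!![(a:ℂ), b; b, d]) =
      !![((α + β * a : ℝ):ℂ), (β * b : ℝ); (β * b : ℝ), (α + β * d : ℝ)] := by
  have hs := k_spec2 a b d μ₁ μ₂ h1 h2
  have hsa := k_sa2 a b d
  have : cfc f (!![(a:ℂ), b; b, d]) = cfc (fun x => α + β * x) (!![(a:ℂ), b; b, d]) := by
    apply cfc_congr
    intro x hx
    rcases hs hx with h | h
    · rw [h]; exact e1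
    · rw [h]; exact e2
  rw [this, cfc_const_add (r := α) (f := fun x => β * x) (a := !![(a:ℂ), b; b, d]) (by fun_prop) hsa,
    cfc_const_mul_id (r := β) (a := !![(a:ℂ), b; b, d]) hsa]
  ext i j; fin_cases i <;> fin_cases j <;> simp [Matrix.algebraMap_matrix_apply]

lemma k_cross (f : ℝ → ℝ)
    (hopmono : ∀ (k : ℕ) (A B : Matrix (Fin k) (Fin k) ℂ),
      IsSelfAdjoint A → IsSelfAdjoint B →
      spectrum ℝ A ⊆ Ioo 0 1 → spectrum ℝ B ⊆ Ioo 0 1 →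
      (B - A).PosSemidef → (cfc f B - cfc f A).PosSemidef)
    (l₁ m₁ l₂ m₂ : ℝ) (h0 : 0 < l₁) (h1 : l₁ < m₁) (h2 : m₁ < l₂) (h3 : l₂ < m₂) (h4 : m₂ < 1) :
    (f m₂ - f l₁) * (f l₂ - f m₁) * ((m₁ - l₁) * (m₂ - l₂)) ≤
    (f m₁ - f l₁) * (f m₂ - f l₂) * ((m₂ - l₁) * (l₂ - m₁)) := by
  have hl : 0 < l₂ - l₁ := by linarith
  have hm : 0 < m₂ - m₁ := by linarith
  obtain ⟨P, hP⟩ : ∃ P, P = (m₁ - l₁) * (m₂ - l₁) / (l₂ - l₁) := ⟨_, rfl⟩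
  obtain ⟨Q, hQ⟩ : ∃ Q, Q = (l₂ - m₁) * (m₂ - l₂) / (l₂ - l₁) := ⟨_, rfl⟩
  have hP0 : 0 ≤ P := by
    rw [hP]; exact div_nonneg (mul_nonneg (by linarith) (by linarith)) hl.le
  have hQ0 : 0 ≤ Q := by
    rw [hQ]; exact div_nonneg (mul_nonneg (by linarith) (by linarith)) hl.le
  obtain ⟨p, hp⟩ : ∃ p, p * p = P := ⟨_, Real.mul_self_sqrt hP0⟩
  obtain ⟨q, hq⟩ : ∃ q, q * q = Q := ⟨_, Real.mul_self_sqrt hQ0⟩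
  obtain ⟨β, hβ⟩ : ∃ β, β = (f m₂ - f m₁) / (m₂ - m₁) := ⟨_, rfl⟩
  obtain ⟨γ, hγ⟩ : ∃ γ, γ = (f l₂ - f l₁) / (l₂ - l₁) := ⟨_, rfl⟩
  have hl' := hl.ne'
  have hm' := hm.ne'
  have tB : (l₁ + P) + (l₂ + Q) = m₁ + m₂ := by rw [hP, hQ]; field_simp; ring
  have dB : (l₁ + P) * (l₂ + Q) - (p * q) * (p * q) = m₁ * m₂ := by
    have : (p * q) * (p * q) = P * Q := by rw [← hp, ← hq]; ring
    rw [this, hP, hQ]; field_simp; ring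
  have tA : l₁ + l₂ = l₁ + l₂ := rfl
  have dA : l₁ * l₂ - 0 * 0 = l₁ * l₂ := by ring
  have hB := k_cfc2 f _ _ _ m₁ m₂ (f m₁ - β * m₁) β tB dB (by ring) (by rw [hβ]; field_simp; ring)
  have hA := k_cfc2 f _ _ _ l₁ l₂ (f l₁ - γ * l₁) γ tA dA (by ring) (by rw [hγ]; field_simp; ring)
  have key := hopmono 2 _ _ (k_sa2 l₁ 0 l₂) (k_sa2 (l₁ + P) (p * q) (l₂ + Q))
    ((k_spec2 _ _ _ l₁ l₂ tA dA).trans (by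
      rintro x (h | h) <;> rw [mem_Ioo, h] <;> constructor <;> linarith))
    ((k_spec2 _ _ _ m₁ m₂ tB dB).trans (by
      rintro x (h | h) <;> rw [mem_Ioo, h] <;> constructor <;> linarith))
    (by
      have := Matrix.posSemidef_vecMulVec_self_star (R := ℂ) ![(p : ℂ), q]
      convert this using 1
      rw [← hp, ← hq]
      ext i j; fin_cases i <;> fin_cases j <;> simp [Matrix.vecMulVec_apply, mul_comm])
  rw [hA, hB] at key
  have hd := key.det_nonneg
  rw [Matrix.det_fin_two] at hd
  simp only [Matrix.sub_apply, Matrix.of_apply, Matrix.cons_val', Matrix.cons_val_zero,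
    Matrix.cons_val_one, Matrix.cons_val_fin_one] at hd
  norm_cast at hd
  have e : (f m₁ - f l₁) * (f m₂ - f l₂) * ((m₂ - l₁) * (l₂ - m₁)) -
     (f m₂ - f l₁) * (f l₂ - f m₁) * ((m₁ - l₁) * (m₂ - l₂)) = (m₂ - m₁) * (l₂ - l₁) *
     ((f m₁ - β * m₁ + β * (l₁ + P) - (f l₁ - γ * l₁ + γ * l₁)) *
     (f m₁ - β * m₁ + β * (l₂ + Q) - (f l₁ - γ * l₁ + γ * l₂)) - β * β * (P * Q)) := by
    rw [hP, hQ, hβ, hγ]; field_simp; ring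
  have e2 : (β * β * (P * Q)) = (β * (p * q) - γ * 0) * (β * (p * q) - γ * 0) := by
    rw [← hp, ← hq]; ring
  rw [e2] at e
  have := mul_nonneg (mul_pos hm hl).le hd
  linarith

lemma k_mono (f : ℝ → ℝ)
    (hopmono : ∀ (k : ℕ) (A B : Matrix (Fin k) (Fin k) ℂ),
      IsSelfAdjoint A → IsSelfAdjoint B →
      spectrum ℝ A ⊆ Ioo 0 1 → spectrum ℝ B ⊆ Ioo 0 1 →
      (B - A).PosSemidef → (cfc f B - cfc f A).PosSemidef)
    (x y : ℝ) (h0 : 0 < x) (h1 : x ≤ y) (h2 : y < 1) : f x ≤ f y := by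
  have key := hopmono 1 (algebraMap ℝ _ x) (algebraMap ℝ _ y) (.algebraMap _ (.all _))
    (.algebraMap _ (.all _))
    (by rw [spectrum.scalar_eq]; rintro _ rfl; constructor <;> linarith)
    (by rw [spectrum.scalar_eq]; rintro _ rfl; constructor <;> linarith)
    (by
      rw [← map_sub]
      have : (0 : ℝ) ≤ y - x := by linarith
      have h : (algebraMap ℝ (Matrix (Fin 1) (Fin 1) ℂ) (y - x)) =
        Matrix.diagonal (fun _ => ((y - x : ℝ) : ℂ)) := by
        ext i j; simp [Matrix.algebraMap_matrix_apply, Matrix.diagonal_apply]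
      rw [h]
      refine Matrix.PosSemidef.diagonal fun i => ?_
      simpa using (Complex.zero_le_real.2 this))
  rw [cfc_algebraMap, cfc_algebraMap, ← map_sub] at key
  have := key.diag_nonneg (i := 0)
  simp [Matrix.algebraMap_matrix_apply] at this
  norm_cast at this

lemma k_strong (f : ℝ → ℝ)
    (hm : ∀ x y : ℝ, 0 < x → x ≤ y → y < 1 → f x ≤ f y)
    (hc : ∀ l₁ m₁ l₂ m₂ : ℝ, 0 < l₁ → l₁ < m₁ → m₁ < l₂ → l₂ < m₂ → m₂ < 1 →
      (f m₂ - f l₁) * (f l₂ - f m₁) * ((m₁ - l₁) * (m₂ - l₂)) ≤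
      (f m₁ - f l₁) * (f m₂ - f l₂) * ((m₂ - l₁) * (l₂ - m₁)))
    (hn : ∃ x ∈ Ioo (0 : ℝ) 1, ∃ y ∈ Ioo (0 : ℝ) 1, f x ≠ f y) :
    ∃ c : ℝ, 0 < c ∧ ∀ x y : ℝ, 0 < x → x ≤ y → y < 1 → c * (y - x) ≤ f y - f x := by
  obtain ⟨p, q, hp, hpq, hq, hlt⟩ : ∃ p q : ℝ, 0 < p ∧ p < q ∧ q < 1 ∧ f p < f q := by
    obtain ⟨x, hx, y, hy, hne⟩ := hn
    rcases lt_trichotomy x y with h | h | h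
    · exact ⟨x, y, hx.1, h, hy.2, lt_of_le_of_ne (hm _ _ hx.1 h.le hy.2) hne⟩
    · subst h; exact absurd rfl hne
    · exact ⟨y, x, hy.1, h, hx.2, lt_of_le_of_ne (hm _ _ hy.1 h.le hx.2) hne.symm⟩
  -- left part
  have hL : ∃ c : ℝ, 0 < c ∧ ∀ x y : ℝ, 0 < x → x ≤ y → y ≤ p → c * (y - x) ≤ f y - f x := by
    obtain ⟨r, hr1, hr2⟩ := exists_between hq
    have hfr := hm q r (by linarith) hr1.le hr2
    refine ⟨(f q - f p) ^ 2 * (r - q) / (f r - f q + 1),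
      div_pos (mul_pos (pow_pos (by linarith) 2) (by linarith)) (by linarith), ?_⟩
    intro x y hx hxy hyp
    rcases hxy.eq_or_lt with rfl | hxy'
    · simp
    have h := hc x y q r hx hxy' (by linarith) hr1 hr2
    have a1 := hm x p hx (by linarith) (by linarith)
    have a2 := hm y p (by linarith) (by linarith) (by linarith)
    have a3 := hm x y hx hxy (by linarith)
    have b1 : (f q - f p) ^ 2 ≤ (f r - f x) * (f q - f y) := by
      rw [sq]; exact mul_le_mul (by linarith) (by linarith) (by linarith) (by linarith)
    have b2 : (r - x) * (q - y) ≤ 1 := by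
      have := mul_le_mul (show r - x ≤ 1 by linarith) (show q - y ≤ 1 by linarith) (by linarith)
        zero_le_one
      linarith
    have b3 : (f q - f p) ^ 2 * ((y - x) * (r - q)) ≤
        (f r - f x) * (f q - f y) * ((y - x) * (r - q)) :=
      mul_le_mul_of_nonneg_right b1 (mul_nonneg (by linarith) (by linarith))
    have b4 : (f y - f x) * (f r - f q) * ((r - x) * (q - y)) ≤ (f y - f x) * (f r - f q) * 1 :=
      mul_le_mul_of_nonneg_left b2 (mul_nonneg (by linarith) (by linarith))
    rw [div_mul_eq_mul_div, div_le_iff₀ (by linarith)]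
    nlinarith
  obtain ⟨c₁, hc₁, hL⟩ := hL
  have hR : ∃ c : ℝ, 0 < c ∧ ∀ x y : ℝ, p ≤ x → x ≤ y → y < 1 → c * (y - x) ≤ f y - f x := by
    have hs : 0 < p / 2 := by linarith
    have hs1 : 0 < f p - f (p / 2) :=
      lt_of_lt_of_le (mul_pos hc₁ (by linarith)) (hL (p / 2) p hs (by linarith) le_rfl)
    have hs2 := hm (p / 4) (p / 2) (by linarith) (by linarith) (by linarith)
    refine ⟨(f p - f (p / 2)) ^ 2 * (p / 4) / (f (p / 2) - f (p / 4) + 1),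
      div_pos (mul_pos (pow_pos (by linarith) 2) (by linarith)) (by linarith), ?_⟩
    intro x y hx hxy hyp
    rcases hxy.eq_or_lt with rfl | hxy'
    · simp
    have h := hc (p / 4) (p / 2) x y (by linarith) (by linarith) (by linarith) hxy' hyp
    have a1 := hm p x hp (by linarith) (by linarith)
    have a3 := hm x y (by linarith) hxy (by linarith)
    have b1 : (f p - f (p / 2)) ^ 2 ≤ (f y - f (p / 4)) * (f x - f (p / 2)) := by
      rw [sq]; exact mul_le_mul (by linarith) (by linarith) (by linarith) (by linarith)
    have b2 : (y - p / 4) * (x - p / 2) ≤ 1 := by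
      have := mul_le_mul (show y - p / 4 ≤ 1 by linarith) (show x - p / 2 ≤ 1 by linarith)
        (by linarith) zero_le_one
      linarith
    have b3 : (f p - f (p / 2)) ^ 2 * ((p / 2 - p / 4) * (y - x)) ≤
        (f y - f (p / 4)) * (f x - f (p / 2)) * ((p / 2 - p / 4) * (y - x)) :=
      mul_le_mul_of_nonneg_right b1 (mul_nonneg (by linarith) (by linarith))
    have b4 : (f (p / 2) - f (p / 4)) * (f y - f x) * ((y - p / 4) * (x - p / 2)) ≤
        (f (p / 2) - f (p / 4)) * (f y - f x) * 1 :=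
      mul_le_mul_of_nonneg_left b2 (mul_nonneg (by linarith) (by linarith))
    rw [div_mul_eq_mul_div, div_le_iff₀ (by linarith)]
    nlinarith
  obtain ⟨c₂, hc₂, hR⟩ := hR
  refine ⟨min c₁ c₂, lt_min hc₁ hc₂, ?_⟩
  have hLm : ∀ x y : ℝ, 0 < x → x ≤ y → y ≤ p → min c₁ c₂ * (y - x) ≤ f y - f x :=
    fun x y a b c => (mul_le_mul_of_nonneg_right (min_le_left _ _) (by linarith)).trans (hL x y a b c)
  have hRm : ∀ x y : ℝ, p ≤ x → x ≤ y → y < 1 → min c₁ c₂ * (y - x) ≤ f y - f x :=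
    fun x y a b c => (mul_le_mul_of_nonneg_right (min_le_right _ _) (by linarith)).trans (hR x y a b c)
  intro x y hx hxy hy
  rcases le_total y p with h | h
  · exact hLm x y hx hxy h
  rcases le_total p x with h' | h'
  · exact hRm x y h' hxy hy
  have := hLm x p hx h' le_rfl
  have := hRm p y le_rfl h hy
  linarith

/-- monotone with one exceptional point -/
lemma k_monoOn (g : ℝ → ℝ) (a b x₀ : ℝ) (hg : ContinuousOn g (Icc a b))
    (hd : ∀ x ∈ Ioo a b, x ≠ x₀ → DifferentiableAt ℝ g x ∧ 0 ≤ deriv g x) :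
    MonotoneOn g (Icc a b) := by
  have main : ∀ c d, a ≤ c → d ≤ b → x₀ ∉ Ioo c d → MonotoneOn g (Icc c d) := by
    intro c d hc hdb hx
    apply monotoneOn_of_deriv_nonneg (convex_Icc _ _) (hg.mono (Icc_subset_Icc hc hdb))
    · intro x h
      rw [interior_Icc] at h
      exact (hd x ⟨by linarith [h.1], by linarith [h.2]⟩
        (by rintro rfl; exact hx h)).1.differentiableWithinAt
    · intro x h
      rw [interior_Icc] at h
      exact (hd x ⟨by linarith [h.1], by linarith [h.2]⟩ (by rintro rfl; exact hx h)).2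
  by_cases h : x₀ ∈ Ioo a b
  · have h1 := main a x₀ le_rfl h.2.le (by simp)
    have h2 := main x₀ b h.1.le le_rfl (by simp)
    have := h1.union_right h2 (isGreatest_Icc h.1.le) (isLeast_Icc h.2.le)
    rwa [Icc_union_Icc_eq_Icc h.1.le h.2.le] at this
  · exact main a b le_rfl le_rfl h

lemma k_scalar (φ : ℝ → ℝ) (hcont : ContinuousOn φ (Icc 0 1)) (c : ℝ) (hc : 0 < c)
    (hs : ∀ x y : ℝ, 0 < x → x ≤ y → y < 1 → c * (y - x) ≤ deriv φ y - deriv φ x)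
    (a b : ℝ) (ha : a ∈ Icc (0:ℝ) 1) (hb : b ∈ Ioo (0:ℝ) 1) :
    c / 2 * ((a - b) * (a - b)) ≤ φ a - φ b - deriv φ b * (a - b) := by
  obtain ⟨x₀, hx₀⟩ : ∃ x₀, ∀ x ∈ Ioo (0:ℝ) 1, x ≠ x₀ → DifferentiableAt ℝ φ x := by
    by_cases h : ∃ x ∈ Ioo (0:ℝ) 1, deriv φ x = 0
    · obtain ⟨x₀, h1, h2⟩ := h
      refine ⟨x₀, fun x hx hne => differentiableAt_of_deriv_ne_zero ?_⟩
      intro h3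
      rcases lt_or_gt_of_ne hne with h | h
      · have := hs x x₀ hx.1 h.le h1.2
        have := mul_pos hc (sub_pos.2 h)
        linarith
      · have := hs x₀ x h1.1 h.le hx.2
        have := mul_pos hc (sub_pos.2 h)
        linarith
    · push Not at h
      exact ⟨0, fun x hx _ => differentiableAt_of_deriv_ne_zero (h x hx)⟩
  set g : ℝ → ℝ := fun t => φ t - deriv φ b * t - c / 2 * ((t - b) * (t - b)) with hg
  have hgc : ContinuousOn g (Icc 0 1) := by
    apply ContinuousOn.sub (hcont.sub (by fun_prop)) (by fun_prop)
  have hgd : ∀ x ∈ Ioo (0:ℝ) 1, x ≠ x₀ →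
      HasDerivAt g (deriv φ x - deriv φ b - c * (x - b)) x := by
    intro x hx hne
    have h1 := (hx₀ x hx hne).hasDerivAt
    have h2 : HasDerivAt (fun t : ℝ => deriv φ b * t) (deriv φ b * 1) x :=
      (hasDerivAt_id x).const_mul _
    have h3 : HasDerivAt (fun t : ℝ => t - b) 1 x := (hasDerivAt_id x).sub_const b
    have := (h1.sub h2).sub ((h3.mul h3).const_mul (c / 2))
    exact this.congr_deriv (by ring)
  rcases le_total b a with h | h
  · have hm := k_monoOn g b 1 x₀ (hgc.mono (Icc_subset_Icc hb.1.le le_rfl)) (by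
      intro x hx hne
      have h' := hgd x ⟨by linarith [hx.1, hb.1], hx.2⟩ hne
      refine ⟨h'.differentiableAt, ?_⟩
      rw [h'.deriv]
      linarith [hs b x hb.1 hx.1.le hx.2])
    have := hm ⟨le_rfl, hb.2.le⟩ ⟨h, ha.2⟩ h
    simp only [hg] at this
    linarith
  · have hm := k_monoOn (fun t => - g t) 0 b x₀
      (hgc.mono (Icc_subset_Icc le_rfl hb.2.le)).neg (by
      intro x hx hne
      have h' := (hgd x ⟨hx.1, by linarith [hx.2, hb.2]⟩ hne).fun_neg
      refine ⟨h'.differentiableAt, ?_⟩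
      rw [h'.deriv]
      linarith [hs x b hx.1 hx.2.le hb.2])
    have := hm ⟨ha.1, h⟩ ⟨hb.1.le, le_rfl⟩ h
    simp only [hg] at this
    linarith

lemma k_trace {N : ℕ} (A B : Matrix (Fin N) (Fin N) ℂ) (hA : A.IsHermitian) (hB : B.IsHermitian) :
    ∃ w : Fin N → Fin N → ℝ, (∀ i j, 0 ≤ w i j) ∧ ∀ g h : ℝ → ℝ,
      (cfc g A * cfc h B).trace =
        ((∑ i, ∑ j, w i j * (g (hA.eigenvalues i) * h (hB.eigenvalues j)) : ℝ) : ℂ) := by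
  set U : Matrix (Fin N) (Fin N) ℂ := (hA.eigenvectorUnitary).1 with hU
  set V : Matrix (Fin N) (Fin N) ℂ := (hB.eigenvectorUnitary).1 with hV
  refine ⟨fun i j => Complex.normSq ((star U * V) i j), fun i j => Complex.normSq_nonneg _, ?_⟩
  intro g h
  rw [hA.cfc_eq, hB.cfc_eq]
  simp only [Matrix.IsHermitian.cfc, Unitary.conjStarAlgAut_apply]
  rw [← hU, ← hV]
  set D := Matrix.diagonal ((RCLike.ofReal : ℝ → ℂ) ∘ g ∘ hA.eigenvalues)
  set E := Matrix.diagonal ((RCLike.ofReal : ℝ → ℂ) ∘ h ∘ hB.eigenvalues)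
  have : (U * D * star U * (V * E * star V)).trace
     = ((D * (star U * V)) * (E * star (star U * V))).trace := by
    rw [show U * D * star U * (V * E * star V) = U * (D * star U * (V * E * star V)) by
      simp only [mul_assoc], Matrix.trace_mul_comm, star_mul, star_star]
    simp only [mul_assoc]
  rw [this, Matrix.trace]
  push_cast
  refine Finset.sum_congr rfl fun i _ => ?_
  rw [Matrix.diag_apply, Matrix.mul_apply]
  refine Finset.sum_congr rfl fun j _ => ?_
  rw [Matrix.diagonal_mul, Matrix.diagonal_mul, Matrix.star_apply, Complex.normSq_eq_conj_mul_self]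
  simp
  ring

lemma k_eig {N : ℕ} (A : Matrix (Fin N) (Fin N) ℂ) (hA : A.IsHermitian)
    (h1 : (1 - A).IsHermitian) (i : Fin N) : ∃ k, h1.eigenvalues k = 1 - hA.eigenvalues i := by
  have h : (1 - hA.eigenvalues i) ∈ spectrum ℝ (1 - A) := by
    have := hA.eigenvalues_mem_spectrum_real i
    have h := spectrum.singleton_sub_eq A (1:ℝ)
    rw [map_one] at h
    rw [← h]
    exact Set.sub_mem_sub rfl this
  rw [h1.spectrum_real_eq_range_eigenvalues] at h
  exact h

/-- Klein lower bound: if `φ` is continuous on `[0,1]` and `φ'` is operator monotone and not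
constant on `(0,1)`, then there is a constant `C > 0` depending only on `φ` such that for all
Hermitian matrices `0 ≤ A ≤ 1` and `0 < B < 1`,
`tr (φ(A) - φ(B) - φ'(B)(A-B)) ≥ C tr ((A-B)²)`, i.e. `H(A,B) ≥ C ‖A-B‖²_HS`. -/
theorem klein_lower_bound (φ : ℝ → ℝ)
    (hcont : ContinuousOn φ (Icc 0 1))
    (hopmono : ∀ (k : ℕ) (A B : Matrix (Fin k) (Fin k) ℂ),
      IsSelfAdjoint A → IsSelfAdjoint B →
      spectrum ℝ A ⊆ Ioo 0 1 → spectrum ℝ B ⊆ Ioo 0 1 →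
      (B - A).PosSemidef → (cfc (deriv φ) B - cfc (deriv φ) A).PosSemidef)
    (hnonconst : ∃ x ∈ Ioo (0 : ℝ) 1, ∃ y ∈ Ioo (0 : ℝ) 1, deriv φ x ≠ deriv φ y) :
    ∃ C : ℝ, 0 < C ∧ ∀ (N : ℕ) (A B : Matrix (Fin N) (Fin N) ℂ),
      IsSelfAdjoint A → IsSelfAdjoint B →
      A.PosSemidef → (1 - A).PosSemidef → B.PosDef → (1 - B).PosDef →
      (C : ℂ) * ((A - B) * (A - B)).trace ≤
        (cfc φ A - cfc φ B - cfc (deriv φ) B * (A - B)).trace := by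
  obtain ⟨c, hc, hs⟩ := k_strong (deriv φ) (k_mono _ hopmono) (k_cross _ hopmono) hnonconst
  refine ⟨c / 2, by linarith, ?_⟩
  intro N A B hA hB hA0 hA1 hB0 hB1
  have hA' : A.IsHermitian := hA0.1
  have hB' : B.IsHermitian := hB0.1
  obtain ⟨w, hw, ht⟩ := k_trace A B hA' hB'
  have ha : ∀ i, hA'.eigenvalues i ∈ Icc (0:ℝ) 1 := by
    intro i
    refine ⟨hA0.eigenvalues_nonneg i, ?_⟩
    obtain ⟨k, hk⟩ := k_eig A hA' hA1.1 i
    have := hA1.eigenvalues_nonneg k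
    linarith
  have hb : ∀ i, hB'.eigenvalues i ∈ Ioo (0:ℝ) 1 := by
    intro i
    refine ⟨hB0.eigenvalues_pos i, ?_⟩
    obtain ⟨k, hk⟩ := k_eig B hB' hB1.1 i
    have := hB1.eigenvalues_pos k
    linarith
  have cont : ∀ (M : Matrix (Fin N) (Fin N) ℂ) (g : ℝ → ℝ), ContinuousOn g (spectrum ℝ M) :=
    fun M g => (Matrix.finite_real_spectrum (A := M)).continuousOn g
  have iA : cfc (fun x : ℝ => x) A = A := cfc_id' ℝ A
  have iB : cfc (fun x : ℝ => x) B = B := cfc_id' ℝ B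
  have oA : cfc (fun _ : ℝ => (1:ℝ)) A = 1 := cfc_const_one ℝ A
  have oB : cfc (fun _ : ℝ => (1:ℝ)) B = 1 := cfc_const_one ℝ B
  have sA : cfc (fun x : ℝ => x * x) A = A * A := by
    rw [cfc_mul _ _ A (cont _ _) (cont _ _), iA]
  have sB : cfc (fun x : ℝ => x * x) B = B * B := by
    rw [cfc_mul _ _ B (cont _ _) (cont _ _), iB]
  have dB : cfc (fun x : ℝ => deriv φ x * x) B = cfc (deriv φ) B * B := by
    rw [cfc_mul _ _ B (cont _ _) (cont _ _), iB]
  have t1 := ht (fun x => x * x) (fun _ => 1)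
  have t2 := ht (fun x => x) (fun x => x)
  have t3 := ht (fun _ => 1) (fun x => x * x)
  have t4 := ht φ (fun _ => 1)
  have t5 := ht (fun _ => 1) φ
  have t6 := ht (fun x => x) (deriv φ)
  have t7 := ht (fun _ => 1) (fun x => deriv φ x * x)
  rw [sA, oB, mul_one] at t1
  rw [iA, iB] at t2
  rw [oA, sB, one_mul] at t3
  rw [oB, mul_one] at t4
  rw [oA, one_mul] at t5
  rw [iA] at t6
  rw [oA, dB, one_mul] at t7
  have e1 : ((A - B) * (A - B)).trace = (A * A).trace - 2 * (A * B).trace + (B * B).trace := by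
    simp only [sub_mul, mul_sub, Matrix.trace_sub]
    rw [Matrix.trace_mul_comm B A]; ring
  have e2 : (cfc φ A - cfc φ B - cfc (deriv φ) B * (A - B)).trace =
      (cfc φ A).trace - (cfc φ B).trace - (A * cfc (deriv φ) B).trace
        + (cfc (deriv φ) B * B).trace := by
    simp only [mul_sub, Matrix.trace_sub]
    rw [Matrix.trace_mul_comm _ A]; ring
  rw [e1, e2, t1, t2, t3, t4, t5, t6, t7]
  norm_cast
  rw [← sub_nonneg]
  have key : 0 ≤ ∑ i, ∑ j, w i j * (φ (hA'.eigenvalues i) - φ (hB'.eigenvalues j)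
      - deriv φ (hB'.eigenvalues j) * (hA'.eigenvalues i - hB'.eigenvalues j)
      - c / 2 * ((hA'.eigenvalues i - hB'.eigenvalues j)
        * (hA'.eigenvalues i - hB'.eigenvalues j))) :=
    Finset.sum_nonneg fun i _ => Finset.sum_nonneg fun j _ => mul_nonneg (hw i j)
      (sub_nonneg.2 (k_scalar φ hcont c hc hs _ _ (ha i) (hb j)))
  refine key.trans_eq ?_
  simp only [Finset.mul_sum, ← Finset.sum_sub_distrib, ← Finset.sum_add_distrib]
  refine Finset.sum_congr rfl fun i _ => Finset.sum_congr rfl fun j _ => ?_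
  ring
end
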